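/- Let α be a Young function satisfying the Δ₂-condition and let r_α = inf_{x>0} x·α'₋(x)/α(x) and p_α = sup_{x>0} x·α'₊(x)/α(x). Then for all x > 0, ξ_α(x) ≤ (p_α − 1) · max( x^{1/(p_α−1)} , x^{1/(r_α−1)} ), where ξ_α(x) = sup_{u>0} α*(x·α'₊(u)) / (x·α(u)), and with the convention x^{∞} = 0 if x ≤ 1 and x^{∞} = ∞ if x > 1 (used when r_α = 1). -/

import Mathlib

open MeasureTheory Filter Set Topology
open scoped ENNReal NNReal

noncomputable section

/-- The right derivative of a function `α : ℝ → ℝ`. -/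
def rightD (α : ℝ → ℝ) (x : ℝ) : ℝ := derivWithin α (Set.Ioi x) x

/-- The left derivative of a function `α : ℝ → ℝ`. -/
def leftD (α : ℝ → ℝ) (x : ℝ) : ℝ := derivWithin α (Set.Iio x) x

/-- A Young function: an even, convex, nonnegative function, increasing on `[0,∞)`,
vanishing at `0` and with vanishing right derivative at `0`. -/
structure IsYoung (α : ℝ → ℝ) : Prop where
  nonneg : ∀ x, 0 ≤ α x
  even : ∀ x, α (-x) = α x
  convex : ConvexOn ℝ Set.univ α
  mono : StrictMonoOn α (Set.Ici 0)
  zero : α 0 = 0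
  rightD_zero : rightD α 0 = 0

/-- The Δ₂-condition for a Young function. -/
def DeltaTwo (α : ℝ → ℝ) : Prop := ∃ K > 0, ∀ x : ℝ, α (2 * x) ≤ K * α x

/-- `r_α = inf_{x>0} x α'₋(x)/α(x)`. -/
def rAlpha (α : ℝ → ℝ) : ℝ := sInf {r : ℝ | ∃ x > 0, r = x * leftD α x / α x}

/-- `p_α = sup_{x>0} x α'₊(x)/α(x)`. -/
def pAlpha (α : ℝ → ℝ) : ℝ := sSup {r : ℝ | ∃ x > 0, r = x * rightD α x / α x}

/-- The Fenchel-Legendre transform `α*(y) = sup_x {xy - α(x)}`, with values in `[0,∞]`. -/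
def legendre (α : ℝ → ℝ) (y : ℝ) : ℝ≥0∞ := ⨆ x : ℝ, ENNReal.ofReal (x * y - α x)

/-- `ξ_α(t) = sup_{u>0} α*(t α'₊(u)) / (t α(u))`. -/
def xiAlpha (α : ℝ → ℝ) (t : ℝ) : ℝ≥0∞ :=
  ⨆ u : {u : ℝ // 0 < u}, legendre α (t * rightD α u) / ENNReal.ofReal (t * α u)

/-- A bounded real-valued function. -/
def IsBoundedFun {Y : Type*} (f : Y → ℝ) : Prop := ∃ M, ∀ x, |f x| ≤ M

variable {X : Type*} [MetricSpace X] [MeasurableSpace X]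

/-- The optimal transport cost `T_α(ν,μ)` between two measures, for the cost
function `(x,y) ↦ α(d(x,y))`. -/
def transportCost (α : ℝ → ℝ) (ν μ : Measure X) : ℝ≥0∞ :=
  sInf { c : ℝ≥0∞ | ∃ π : Measure (X × X), π.map Prod.fst = ν ∧ π.map Prod.snd = μ ∧
      c = ∫⁻ z, ENNReal.ofReal (α (dist z.1 z.2)) ∂π }

open Classical in
/-- The relative entropy `H(ν|μ) = ∫ log (dν/dμ) dν` if `ν ≪ μ` (and `+∞` if `ν` is not
absolutely continuous with respect to `μ`, or if the integral diverges). -/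
def relEnt (ν μ : Measure X) : ℝ≥0∞ :=
  if ν ≪ μ ∧ Integrable (fun x => Real.log (ν.rnDeriv μ x).toReal) ν
  then ENNReal.ofReal (∫ x, Real.log (ν.rnDeriv μ x).toReal ∂ν) else ⊤

/-- The transport-entropy inequality `T_α(C)`: for every probability measure `ν`,
`T_α(ν,μ) ≤ C H(ν|μ)`. -/
def TransportEntropy (μ : Measure X) (α : ℝ → ℝ) (C : ℝ) : Prop :=
  ∀ ν : Measure X, IsProbabilityMeasure ν →
    transportCost α ν μ ≤ ENNReal.ofReal C * relEnt ν μ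

/-- The entropy functional `Ent_μ(e^f)`. -/
def entExp (μ : Measure X) (f : X → ℝ) : ℝ :=
  ∫ x, Real.exp (f x) * Real.log (Real.exp (f x)) ∂μ
    - (∫ x, Real.exp (f x) ∂μ) * Real.log (∫ x, Real.exp (f x) ∂μ)

/-- `|∇⁺ f|(x) = limsup_{y → x} [f(y) - f(x)]₊ / d(y,x)` (equal to `0` at isolated
points by the conventions on `limsup` and `sInf` in `ℝ`). -/
def gradPlus (f : X → ℝ) (x : X) : ℝ :=
  limsup (fun y => max (f y - f x) 0 / dist y x) (𝓝[≠] x)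

/-- `|∇⁻ f|(x) = limsup_{y → x} [f(y) - f(x)]₋ / d(y,x)` (equal to `0` at isolated
points by the conventions on `limsup` and `sInf` in `ℝ`). -/
def gradMinus (f : X → ℝ) (x : X) : ℝ :=
  limsup (fun y => max (-(f y - f x)) 0 / dist y x) (𝓝[≠] x)

/-- The modified log-Sobolev inequality plus `LSI⁺_α(A)`. -/
def LSIplus (μ : Measure X) (α : ℝ → ℝ) (A : ℝ) : Prop :=
  ∀ f : X → ℝ, IsBoundedFun f → LocallyLipschitz f →
    ENNReal.ofReal (entExp μ f) ≤
      ENNReal.ofReal A * ∫⁻ x, legendre α (gradPlus f x) * ENNReal.ofReal (Real.exp (f x)) ∂μ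

/-- The modified log-Sobolev inequality minus `LSI⁻_α(A)`. -/
def LSIminus (μ : Measure X) (α : ℝ → ℝ) (A : ℝ) : Prop :=
  ∀ f : X → ℝ, IsBoundedFun f → LocallyLipschitz f →
    ENNReal.ofReal (entExp μ f) ≤
      ENNReal.ofReal A * ∫⁻ x, legendre α (gradMinus f x) * ENNReal.ofReal (Real.exp (f x)) ∂μ

/-- The inf-convolution operator `Q_α^λ f(x) = inf_y {f(y) + λ α(d(x,y))}`. -/
def QInf (α : ℝ → ℝ) (lam : ℝ) (f : X → ℝ) (x : X) : ℝ :=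
  ⨅ y : X, (f y + lam * α (dist x y))

/-- The `(τ)`-log-Sobolev inequality `(τ)-LSI_α(λ, A)`. -/
def TauLSI (μ : Measure X) (α : ℝ → ℝ) (lam A : ℝ) : Prop :=
  ∀ f : X → ℝ, IsBoundedFun f → LocallyLipschitz f →
    entExp μ f ≤ A * ∫ x, (f x - QInf α lam f x) * Real.exp (f x) ∂μ

/-- The `n`-dimensional inf-convolution operator
`Q_{α,n} f(x) = inf_y {f(y) + Σᵢ α(d(xᵢ,yᵢ))}`. -/
def QInfN (α : ℝ → ℝ) {n : ℕ} (f : (Fin n → X) → ℝ) (x : Fin n → X) : ℝ :=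
  ⨅ y : Fin n → X, (f y + ∑ i, α (dist (x i) (y i)))

/-- The `n`-dimensional sup-convolution operator
`P_{α,n} f(x) = sup_y {f(y) - Σᵢ α(d(xᵢ,yᵢ))}`. -/
def PSupN (α : ℝ → ℝ) {n : ℕ} (f : (Fin n → X) → ℝ) (x : Fin n → X) : ℝ :=
  ⨆ y : Fin n → X, (f y - ∑ i, α (dist (x i) (y i)))

end


namespace IsYoung

variable {α : ℝ → ℝ}

lemma pos (hα : IsYoung α) {x : ℝ} (hx : 0 < x) : 0 < α x := by
  simpa [hα.zero] using hα.mono (self_mem_Ici (a := (0 : ℝ))) hx.le hx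

lemma apply_abs (hα : IsYoung α) (x : ℝ) : α |x| = α x := by
  rcases abs_choice x with h | h <;> rw [h]
  exact hα.even x

lemma hasDerivWithinAt_rightD (hα : IsYoung α) (x : ℝ) :
    HasDerivWithinAt α (rightD α x) (Ioi x) x :=
  hα.convex.hasDerivWithinAt_rightDeriv_of_mem_interior (by simp)

lemma continuous (hα : IsYoung α) : Continuous α :=
  continuousOn_univ.1 (hα.convex.continuousOn isOpen_univ)

lemma leftD_le_rightD (hα : IsYoung α) (x : ℝ) : leftD α x ≤ rightD α x :=
  hα.convex.leftDeriv_le_rightDeriv_of_mem_interior (by simp)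

/-- The right derivative is a subgradient. -/
lemma add_rightD_mul_le (hα : IsYoung α) (u v : ℝ) :
    α u + rightD α u * (v - u) ≤ α v := by
  rcases lt_trichotomy u v with h | rfl | h
  · have := hα.convex.rightDeriv_le_slope_of_mem_interior (x := u) (y := v) (by simp) (by simp) h
    rw [slope_def_field, le_div_iff₀ (sub_pos.2 h)] at this
    change rightD α u * _ ≤ _ at this
    linarith
  · simp
  · have := (hα.convex.slope_le_leftDeriv_of_mem_interior (x := v) (y := u) (by simp) (by simp)
      h).trans (hα.leftD_le_rightD u)
    rw [slope_def_field, div_le_iff₀ (sub_pos.2 h)] at this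
    linarith

lemma le_mul_leftD (hα : IsYoung α) {x : ℝ} (hx : 0 < x) : α x ≤ x * leftD α x := by
  have := hα.convex.slope_le_leftDeriv_of_mem_interior (x := 0) (y := x) (by simp) (by simp) hx
  rw [slope_def_field, hα.zero, div_le_iff₀ (by simpa using hx)] at this
  change _ ≤ leftD α x * _ at this
  linarith

lemma mul_rightD_le (hα : IsYoung α) (hΔ : DeltaTwo α) {x : ℝ} (hx : 0 < x) :
    x * rightD α x ≤ pAlpha α * α x := by
  obtain ⟨K, -, hK⟩ := hΔ
  rw [← div_le_iff₀ (hα.pos hx)]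
  refine le_csSup ⟨K, ?_⟩ ⟨x, hx, rfl⟩
  rintro _ ⟨y, hy, rfl⟩
  rw [div_le_iff₀ (hα.pos hy)]
  linarith [hα.add_rightD_mul_le y (2 * y), hK y, hα.nonneg y]

lemma one_le_rAlpha (hα : IsYoung α) : 1 ≤ rAlpha α := by
  refine le_csInf ⟨_, 1, one_pos, rfl⟩ ?_
  rintro _ ⟨y, hy, rfl⟩
  rw [le_div_iff₀ (hα.pos hy), one_mul]
  exact hα.le_mul_leftD hy

lemma rAlpha_mul_le (hα : IsYoung α) {x : ℝ} (hx : 0 < x) :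
    rAlpha α * α x ≤ x * rightD α x := by
  refine le_trans ?_ (mul_le_mul_of_nonneg_left (hα.leftD_le_rightD x) hx.le)
  rw [← le_div_iff₀ (hα.pos hx)]
  refine csInf_le ⟨1, ?_⟩ ⟨x, hx, rfl⟩
  rintro _ ⟨y, hy, rfl⟩
  rw [le_div_iff₀ (hα.pos hy), one_mul]
  exact hα.le_mul_leftD hy

lemma hasDerivWithinAt_mul_rpow_neg (hα : IsYoung α) (q : ℝ) {v : ℝ} (hv : 0 < v) :
    HasDerivWithinAt (fun v => α v * v ^ (-q))
      ((v * rightD α v - q * α v) * v ^ (-q - 1)) (Ici v) v := by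
  refine ((hα.hasDerivWithinAt_rightD v).Ici_of_Ioi.mul
    (Real.hasDerivAt_rpow_const (p := -q) (Or.inl hv.ne')).hasDerivWithinAt).congr_deriv ?_
  rw [Real.rpow_sub_one hv.ne']
  field_simp
  ring

lemma continuousOn_mul_rpow_neg (hα : IsYoung α) (q : ℝ) {a b : ℝ} (ha : 0 < a) :
    ContinuousOn (fun v => α v * v ^ (-q)) (Icc a b) :=
  hα.continuous.continuousOn.mul
    (continuousOn_id.rpow_const fun _ hv => Or.inl (ha.trans_le hv.1).ne')

lemma mul_rpow_neg_antitone (hα : IsYoung α) {q : ℝ}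
    (hq : ∀ v > 0, v * rightD α v ≤ q * α v) {a b : ℝ} (ha : 0 < a) (hab : a ≤ b) :
    α b * b ^ (-q) ≤ α a * a ^ (-q) := by
  refine image_le_of_deriv_right_le_deriv_boundary (B := fun _ => α a * a ^ (-q)) (B' := 0)
    (hα.continuousOn_mul_rpow_neg q ha)
    (fun v hv => hα.hasDerivWithinAt_mul_rpow_neg q (ha.trans_le hv.1)) le_rfl
    continuousOn_const (fun _ _ => hasDerivWithinAt_const ..) (fun v hv => ?_) (right_mem_Icc.2 hab)
  have hv0 := ha.trans_le hv.1
  exact mul_nonpos_of_nonpos_of_nonneg (sub_nonpos.2 (hq v hv0)) (by positivity)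

lemma mul_rpow_neg_monotone (hα : IsYoung α) {q : ℝ}
    (hq : ∀ v > 0, q * α v ≤ v * rightD α v) {a b : ℝ} (ha : 0 < a) (hab : a ≤ b) :
    α a * a ^ (-q) ≤ α b * b ^ (-q) := by
  refine image_le_of_deriv_right_le_deriv_boundary (f := fun _ => α a * a ^ (-q)) (f' := 0)
    (B := fun v => α v * v ^ (-q))
    continuousOn_const (fun _ _ => hasDerivWithinAt_const ..) le_rfl
    (hα.continuousOn_mul_rpow_neg q ha)
    (fun v hv => hα.hasDerivWithinAt_mul_rpow_neg q (ha.trans_le hv.1))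
    (fun v hv => ?_) (right_mem_Icc.2 hab)
  have hv0 := ha.trans_le hv.1
  exact mul_nonneg (sub_nonneg.2 (hq v hv0)) (by positivity)

lemma rpow_mul_le_of_mul_rpow_neg_le (hα : IsYoung α) {q s : ℝ} (hs : 0 < s)
    (h : ∀ w > 0, α w * w ^ (-q) ≤ α (s * w) * (s * w) ^ (-q)) (w : ℝ) :
    s ^ q * α w ≤ α (s * w) := by
  rw [← hα.apply_abs w, ← hα.apply_abs (s * w), abs_mul, abs_of_pos hs]
  rcases (abs_nonneg w).eq_or_lt' with hw | hw
  · simp [hw, hα.zero]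
  · have := h _ hw
    rw [Real.mul_rpow hs.le hw.le, ← mul_assoc, mul_le_mul_iff_left₀ (by positivity),
      Real.rpow_neg hs.le, ← div_eq_mul_inv, le_div_iff₀ (by positivity)] at this
    linarith

lemma rpow_mul_le_of_le_one (hα : IsYoung α) {q : ℝ}
    (hq : ∀ v > 0, v * rightD α v ≤ q * α v) {s : ℝ} (hs : 0 < s) (hs1 : s ≤ 1) (w : ℝ) :
    s ^ q * α w ≤ α (s * w) :=
  hα.rpow_mul_le_of_mul_rpow_neg_le hs (fun w hw =>
    hα.mul_rpow_neg_antitone hq (by positivity) (mul_le_of_le_one_left hw.le hs1)) w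

lemma rpow_mul_le_of_one_le (hα : IsYoung α) {q : ℝ}
    (hq : ∀ v > 0, q * α v ≤ v * rightD α v) {s : ℝ} (hs1 : 1 ≤ s) (w : ℝ) :
    s ^ q * α w ≤ α (s * w) :=
  hα.rpow_mul_le_of_mul_rpow_neg_le (one_pos.trans_le hs1) (fun _ hw =>
    hα.mul_rpow_neg_monotone hq hw (le_mul_of_one_le_left hw.le hs1)) w

lemma one_lt_pAlpha (hα : IsYoung α) (hΔ : DeltaTwo α) : 1 < pAlpha α := by
  by_contra! hp
  have hq : ∀ v > 0, v * rightD α v ≤ 1 * α v := fun v hv =>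
    (hα.mul_rightD_le hΔ hv).trans (mul_le_mul_of_nonneg_right hp (hα.nonneg v))
  have hder := hα.hasDerivWithinAt_rightD 0
  rw [hα.rightD_zero, hasDerivWithinAt_iff_tendsto_slope' (by simp)] at hder
  refine (hα.pos one_pos).not_ge (ge_of_tendsto hder ?_)
  filter_upwards [Ioo_mem_nhdsGT (one_pos : (0 : ℝ) < 1)] with s hs
  have := hα.rpow_mul_le_of_le_one hq hs.1 hs.2.le 1
  rw [Real.rpow_one, mul_one] at this
  rw [slope_def_field, hα.zero, sub_zero, sub_zero, le_div_iff₀ hs.1]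
  linarith

lemma legendre_rightD_le (hα : IsYoung α) (hΔ : DeltaTwo α) {u : ℝ} (hu : 0 < u) :
    legendre α (rightD α u) ≤ ENNReal.ofReal ((pAlpha α - 1) * α u) :=
  iSup_le fun v => ENNReal.ofReal_le_ofReal <| by
    linarith [hα.add_rightD_mul_le u v, hα.mul_rightD_le hΔ hu]

end IsYoung

lemma legendre_rpow_mul_le {α : ℝ → ℝ} {s q : ℝ} (hs : 0 < s)
    (h : ∀ w, s ^ q * α w ≤ α (s * w)) (y : ℝ) :
    legendre α (s ^ (q - 1) * y) ≤ ENNReal.ofReal (s ^ q) * legendre α y := by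
  refine iSup_le fun v => ?_
  calc ENNReal.ofReal (v * (s ^ (q - 1) * y) - α v)
      ≤ ENNReal.ofReal (s ^ q * (v / s * y - α (v / s))) := by
        have := h (v / s)
        rw [mul_div_cancel₀ v hs.ne'] at this
        refine ENNReal.ofReal_le_ofReal ?_
        have h' : v * (s ^ (q - 1) * y) = s ^ q * (v / s * y) := by
          rw [Real.rpow_sub_one hs.ne']
          ring
        linarith
    _ = ENNReal.ofReal (s ^ q) * ENNReal.ofReal (v / s * y - α (v / s)) :=
        ENNReal.ofReal_mul (by positivity)
    _ ≤ _ := by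
        gcongr
        exact le_iSup (fun x => ENNReal.ofReal (x * y - α x)) (v / s)

lemma IsYoung.xiAlpha_le_mul_rpow {α : ℝ → ℝ} (hα : IsYoung α) (hΔ : DeltaTwo α) {x q : ℝ}
    (hx : 0 < x) (hq : q ≠ 1)
    (h : ∀ w, (x ^ (1 / (q - 1))) ^ q * α w ≤ α (x ^ (1 / (q - 1)) * w)) :
    xiAlpha α x ≤ ENNReal.ofReal (pAlpha α - 1) * ENNReal.ofReal x ^ (1 / (q - 1)) := by
  refine iSup_le fun ⟨u, hu⟩ => ?_
  have hu' := hα.pos hu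
  have hp := sub_pos.2 (hα.one_lt_pAlpha hΔ)
  rw [ENNReal.ofReal_rpow_of_pos hx, ← ENNReal.ofReal_mul hp.le]
  set s := x ^ (1 / (q - 1)) with hsdef
  have hs : 0 < s := by positivity
  have hxs : s ^ (q - 1) = x := by
    rw [hsdef, ← Real.rpow_mul hx.le, one_div_mul_cancel (sub_ne_zero.2 hq), Real.rpow_one]
  refine ENNReal.div_le_of_le_mul ?_
  calc legendre α (x * rightD α u)
      ≤ ENNReal.ofReal (s ^ q) * legendre α (rightD α u) := by
        simpa only [hxs] using legendre_rpow_mul_le hs h (rightD α u)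
    _ ≤ ENNReal.ofReal (s ^ q) * ENNReal.ofReal ((pAlpha α - 1) * α u) := by
        gcongr
        exact hα.legendre_rightD_le hΔ hu
    _ = ENNReal.ofReal ((pAlpha α - 1) * s) * ENNReal.ofReal (x * α u) := by
        rw [← ENNReal.ofReal_mul (by positivity), ← ENNReal.ofReal_mul (by positivity), ← hxs,
          Real.rpow_sub_one hs.ne']
        congr 1
        field_simp

open Classical in
theorem xiAlpha_le (α : ℝ → ℝ) (hα : IsYoung α) (hΔ : DeltaTwo α) :
    ∀ x : ℝ, 0 < x →
      xiAlpha α x ≤ ENNReal.ofReal (pAlpha α - 1) *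
        max ((ENNReal.ofReal x) ^ (1 / (pAlpha α - 1)))
          (if rAlpha α = 1 then (if x ≤ 1 then 0 else (⊤ : ℝ≥0∞))
           else (ENNReal.ofReal x) ^ (1 / (rAlpha α - 1))) := by
  intro x hx
  have hp := hα.one_lt_pAlpha hΔ
  have hp' := sub_pos.2 hp
  rcases le_or_gt x 1 with hx1 | hx1
  · refine (hα.xiAlpha_le_mul_rpow hΔ hx hp.ne' ?_).trans (mul_le_mul_right (le_max_left _ _) _)
    exact hα.rpow_mul_le_of_le_one (fun v hv => hα.mul_rightD_le hΔ hv) (by positivity)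
      (Real.rpow_le_one hx.le hx1 (by positivity))
  · split_ifs with hr hx2
    · exact absurd hx2 hx1.not_ge
    · simp [ENNReal.mul_top, hp]
    · have hr' := sub_nonneg.2 hα.one_le_rAlpha
      refine (hα.xiAlpha_le_mul_rpow hΔ hx hr ?_).trans (mul_le_mul_right (le_max_right _ _) _)
      exact hα.rpow_mul_le_of_one_le (fun v hv => hα.rAlpha_mul_le hv)
        (Real.one_le_rpow hx1.le (by positivity))
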